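/- Let P ∈ 𝒫ₙ \ {I^{⊗n}} and let Û be the channel representation of R(P). Then every off-diagonal entry of Û (i.e., Û_{rs} with P_r ≠ P_s) belongs to the set {0, 1/√2, −1/√2}. -/

import Mathlib

open Matrix Complex

/-- The four single-qubit Pauli matrices I, X, Y, Z. -/
noncomputable def pauli : Fin 4 → Matrix (Fin 2) (Fin 2) ℂ :=
  ![1, !![0, 1; 1, 0], !![0, -Complex.I; Complex.I, 0], !![1, 0; 0, -1]]

/-- The n-qubit Pauli matrix A₁ ⊗ ⋯ ⊗ Aₙ (Kronecker product realized entrywise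
on the index type `Fin n → Fin 2`). -/
noncomputable def nPauli {n : ℕ} (A : Fin n → Fin 4) :
    Matrix (Fin n → Fin 2) (Fin n → Fin 2) ℂ :=
  fun x y => ∏ j, pauli (A j) (x j) (y j)

/-- R(P) = ½(1+e^{iπ/4})·I + ½(1−e^{iπ/4})·P. -/
noncomputable def RP {n : ℕ} (A : Fin n → Fin 4) :
    Matrix (Fin n → Fin 2) (Fin n → Fin 2) ℂ :=
  ((1 + Complex.exp (Complex.I * Real.pi / 4)) / 2) • 1 +
    ((1 - Complex.exp (Complex.I * Real.pi / 4)) / 2) • nPauli A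

/-- The channel representation: Û_{rs} = (1/2ⁿ)·Tr(P_r U P_s U†). -/
noncomputable def chanRep {n : ℕ} (U : Matrix (Fin n → Fin 2) (Fin n → Fin 2) ℂ) :
    Matrix (Fin n → Fin 4) (Fin n → Fin 4) ℂ :=
  fun r s => (1 / 2 ^ n : ℂ) * (nPauli r * U * nPauli s * Uᴴ).trace

/-- The Kronecker product of a family of one-qubit matrices, realized entrywise. -/
noncomputable def kroneckerFamily {n : ℕ} (M : Fin n → Matrix (Fin 2) (Fin 2) ℂ) :
    Matrix (Fin n → Fin 2) (Fin n → Fin 2) ℂ :=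
  fun x y => ∏ j, M j (x j) (y j)

theorem nPauli_eq_kroneckerFamily {n : ℕ} (A : Fin n → Fin 4) :
    nPauli A = kroneckerFamily (fun j => pauli (A j)) := rfl

theorem kroneckerFamily_mul {n : ℕ} (M N : Fin n → Matrix (Fin 2) (Fin 2) ℂ) :
    kroneckerFamily M * kroneckerFamily N = kroneckerFamily (fun j => M j * N j) := by
  ext x y
  simp only [kroneckerFamily, Matrix.mul_apply, ← Finset.prod_mul_distrib]
  rw [Finset.prod_univ_sum, Fintype.piFinset_univ]

theorem trace_kroneckerFamily {n : ℕ} (M : Fin n → Matrix (Fin 2) (Fin 2) ℂ) :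
    (kroneckerFamily M).trace = ∏ j, (M j).trace := by
  simp only [kroneckerFamily, Matrix.trace, Matrix.diag_apply]
  rw [Finset.prod_univ_sum, Fintype.piFinset_univ]

theorem conjTranspose_pauli (a : Fin 4) : (pauli a)ᴴ = pauli a := by
  ext i j
  fin_cases a <;> fin_cases i <;> fin_cases j <;> simp [pauli]

theorem conjTranspose_nPauli {n : ℕ} (A : Fin n → Fin 4) : (nPauli A)ᴴ = nPauli A := by
  ext x y
  simp only [Matrix.conjTranspose_apply, nPauli, star_prod]
  refine Finset.prod_congr rfl fun j _ => ?_
  rw [← Matrix.conjTranspose_apply, conjTranspose_pauli]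

theorem trace_pauli_mul_pauli {r s : Fin 4} (h : r ≠ s) :
    (pauli r * pauli s).trace = 0 := by
  fin_cases r <;> fin_cases s <;>
    simp_all [pauli, Matrix.trace_fin_two, Matrix.one_fin_two]

theorem pauli_mul_pauli_mul_pauli (a s : Fin 4) :
    pauli a * pauli s * pauli a = pauli s ∨ pauli a * pauli s * pauli a = -pauli s := by
  fin_cases a <;> fin_cases s <;> simp [pauli, Matrix.one_fin_two]

theorem half_trace_pauli_pow_five (r s a : Fin 4) :
    ((pauli r * pauli s * pauli a).trace / 2) ^ 5 =
      (pauli r * pauli s * pauli a).trace / 2 := by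
  have hI : Complex.I ^ 5 = Complex.I := by
    rw [show (5 : ℕ) = 4 + 1 from rfl, pow_succ, Complex.I_pow_four, one_mul]
  have hI' : (-Complex.I) ^ 5 = -Complex.I := by
    rw [Odd.neg_pow (by decide), hI]
  have h1 : (1 + 1 : ℂ) / 2 = 1 := by norm_num
  have h3 : (Complex.I + Complex.I) / 2 = Complex.I := by ring
  have h4 : (-Complex.I + -Complex.I) / 2 = -Complex.I := by ring
  fin_cases r <;> fin_cases s <;> fin_cases a <;>
    simp [pauli, Matrix.trace_fin_two, Matrix.one_fin_two, h1, h3, h4, hI, hI']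

theorem trace_nPauli_mul_nPauli {n : ℕ} {r s : Fin n → Fin 4} (h : r ≠ s) :
    (nPauli r * nPauli s).trace = 0 := by
  obtain ⟨j, hj⟩ := Function.ne_iff.mp h
  simp only [nPauli_eq_kroneckerFamily, kroneckerFamily_mul, trace_kroneckerFamily]
  exact Finset.prod_eq_zero (Finset.mem_univ j) (trace_pauli_mul_pauli hj)

theorem trace_nPauli_mul_conj {n : ℕ} (A : Fin n → Fin 4) {r s : Fin n → Fin 4} (h : r ≠ s) :
    (nPauli r * (nPauli A * nPauli s * nPauli A)).trace = 0 := by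
  obtain ⟨j, hj⟩ := Function.ne_iff.mp h
  simp only [nPauli_eq_kroneckerFamily, kroneckerFamily_mul, trace_kroneckerFamily]
  refine Finset.prod_eq_zero (Finset.mem_univ j) ?_
  rcases pauli_mul_pauli_mul_pauli (A j) (s j) with h | h <;>
    simp [h, trace_pauli_mul_pauli hj]

theorem normalized_trace_nPauli_pow_five {n : ℕ} (r s A : Fin n → Fin 4) :
    ((nPauli r * nPauli s * nPauli A).trace / 2 ^ n) ^ 5 =
      (nPauli r * nPauli s * nPauli A).trace / 2 ^ n := by
  have h : (nPauli r * nPauli s * nPauli A).trace / 2 ^ n =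
      ∏ j, (pauli (r j) * pauli (s j) * pauli (A j)).trace / 2 := by
    simp [nPauli_eq_kroneckerFamily, kroneckerFamily_mul, trace_kroneckerFamily,
      Finset.prod_div_distrib]
  rw [h, ← Finset.prod_pow]
  exact Finset.prod_congr rfl fun j _ => half_trace_pauli_pow_five _ _ _

theorem star_trace_nPauli {n : ℕ} (r s A : Fin n → Fin 4) :
    star (nPauli r * nPauli s * nPauli A).trace = (nPauli r * nPauli A * nPauli s).trace := by
  rw [← Matrix.trace_conjTranspose]
  simp only [Matrix.conjTranspose_mul, conjTranspose_nPauli]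
  rw [← Matrix.mul_assoc, Matrix.trace_mul_comm, Matrix.mul_assoc]

theorem sub_star_of_pow_five_eq_self {t : ℂ} (h : t ^ 5 = t) :
    t - star t = 0 ∨ t - star t = 2 * Complex.I ∨ t - star t = -(2 * Complex.I) := by
  have hf : t * ((t - 1) * ((t + 1) * ((t - Complex.I) * (t + Complex.I)))) = 0 := by
    linear_combination h + (t - t ^ 3) * Complex.I_sq
  simp only [mul_eq_zero, sub_eq_zero, add_eq_zero_iff_eq_neg] at hf
  rcases hf with rfl | rfl | rfl | rfl | rfl
  · simp
  · simp
  · simp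
  · right; left; simp; ring
  · right; right; simp; ring

theorem exp_I_mul_pi_div_four :
    Complex.exp (Complex.I * Real.pi / 4) =
      (Real.sqrt 2 : ℂ)⁻¹ + (Real.sqrt 2 : ℂ)⁻¹ * Complex.I := by
  have h2 : (Real.sqrt 2 : ℂ) * Real.sqrt 2 = 2 := by
    exact_mod_cast Real.mul_self_sqrt (by norm_num : (0 : ℝ) ≤ 2)
  have h0 : (Real.sqrt 2 : ℂ) ≠ 0 := by
    exact_mod_cast (Real.sqrt_pos.mpr (by norm_num : (0 : ℝ) < 2)).ne'
  have hinv : (Real.sqrt 2 : ℂ) / 2 = (Real.sqrt 2 : ℂ)⁻¹ := by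
    field_simp
    linear_combination h2
  rw [show Complex.I * Real.pi / 4 = ((Real.pi / 4 : ℝ) : ℂ) * Complex.I by push_cast; ring,
    Complex.exp_mul_I, ← Complex.ofReal_cos, ← Complex.ofReal_sin, Real.cos_pi_div_four,
    Real.sin_pi_div_four]
  push_cast
  rw [hinv]

theorem chanRep_RP_of_ne {n : ℕ} (A : Fin n → Fin 4) {r s : Fin n → Fin 4} (hrs : r ≠ s) :
    chanRep (RP A) r s = Complex.I / 2 * (Real.sqrt 2 : ℂ)⁻¹ *
      ((nPauli r * nPauli s * nPauli A).trace / 2 ^ n -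
        star ((nPauli r * nPauli s * nPauli A).trace / 2 ^ n)) := by
  have hc : ((Real.sqrt 2 : ℂ)⁻¹) ^ 2 = 1 / 2 := by
    rw [inv_pow]
    norm_cast
    rw [Real.sq_sqrt (by norm_num)]
    norm_num
  have hstar : star ((Real.sqrt 2 : ℂ)⁻¹) = (Real.sqrt 2 : ℂ)⁻¹ := by simp
  have h1 := trace_nPauli_mul_nPauli hrs
  have h2 := trace_nPauli_mul_conj A hrs
  have h3 := star_trace_nPauli r s A
  simp only [star_div₀, h3, star_pow, star_ofNat]
  unfold chanRep RP
  rw [exp_I_mul_pi_div_four]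
  generalize (Real.sqrt 2 : ℂ)⁻¹ = c at *
  simp only [Matrix.conjTranspose_add, Matrix.conjTranspose_smul, Matrix.conjTranspose_one,
    conjTranspose_nPauli, star_div₀, star_add, star_sub, star_mul', hstar, star_one, star_ofNat,
    Complex.star_def, Complex.conj_I]
  simp only [Matrix.mul_add, Matrix.add_mul, Matrix.mul_smul, Matrix.smul_mul, Matrix.mul_one,
    Matrix.trace_add, Matrix.trace_smul, smul_eq_mul, ← Matrix.mul_assoc] at h2 ⊢
  rw [h1, h2]
  generalize (nPauli r * nPauli s * nPauli A).trace = t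
  generalize (nPauli r * nPauli A * nPauli s).trace = t'
  have key : (1 + (c + c * Complex.I)) * (1 - (c + c * -Complex.I)) = 2 * c * Complex.I := by
    linear_combination -2 * hc + c ^ 2 * Complex.I_sq
  have key' : (1 - (c + c * Complex.I)) * (1 + (c + c * -Complex.I)) = -(2 * c * Complex.I) := by
    linear_combination -2 * hc + c ^ 2 * Complex.I_sq
  linear_combination (1 / 2 ^ n / 4 * t) * key + (1 / 2 ^ n / 4 * t') * key'

/-- every off-diagonal entry of Û lies in {0, 1/√2, −1/√2}. -/
theorem chanRep_offdiag_values {n : ℕ} (A : Fin n → Fin 4) (hA : A ≠ 0)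
    (r s : Fin n → Fin 4) (hrs : r ≠ s) :
    chanRep (RP A) r s = 0 ∨ chanRep (RP A) r s = (Real.sqrt 2 : ℂ)⁻¹ ∨
      chanRep (RP A) r s = -(Real.sqrt 2 : ℂ)⁻¹ := by
  rw [chanRep_RP_of_ne A hrs]
  rcases sub_star_of_pow_five_eq_self (normalized_trace_nPauli_pow_five r s A) with h | h | h <;>
    rw [h]
  · simp
  · right; right
    linear_combination (Real.sqrt 2 : ℂ)⁻¹ * Complex.I_sq
  · right; left
    linear_combination -(Real.sqrt 2 : ℂ)⁻¹ * Complex.I_sq
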